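/- Define P₋ : (√2, ∞) → ℝ by P₋(A) = 4·∫₀^A du / √((A² − u²)·(A²/2 + u²/2 − 1)). Then P₋ is strictly decreasing on (√2, ∞), P₋(A) tends to +∞ as A → √2⁺, and P₋(A) tends to 0 as A → ∞. -/

import Mathlib

open intervalIntegral Filter

/-- The period function of the double-well Duffing equation (positive-energy branch)
as a function of the amplitude `A`. -/
noncomputable def Pminus (A : ℝ) : ℝ :=
  4 * ∫ u in (0:ℝ)..A, 1 / Real.sqrt ((A ^ 2 - u ^ 2) * (A ^ 2 / 2 + u ^ 2 / 2 - 1))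

theorem half_sq_sub_one_pos {A : ℝ} (hA : Real.sqrt 2 < A) : 0 < A ^ 2 / 2 - 1 := by
  have := (Real.sqrt_lt' ((Real.sqrt_nonneg 2).trans_lt hA)).1 hA
  linarith

theorem half_sq_sub_one_le (A θ : ℝ) :
    A ^ 2 / 2 - 1 ≤ A ^ 2 / 2 * (1 + Real.sin θ ^ 2) - 1 := by
  nlinarith [mul_nonneg (sq_nonneg A) (sq_nonneg (Real.sin θ))]

theorem radicand_pos {A : ℝ} (hA : Real.sqrt 2 < A) (θ : ℝ) :
    0 < A ^ 2 / 2 * (1 + Real.sin θ ^ 2) - 1 :=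
  (half_sq_sub_one_pos hA).trans_le (half_sq_sub_one_le A θ)

theorem continuous_regularIntegrand {A : ℝ} (hA : Real.sqrt 2 < A) :
    Continuous fun θ : ℝ => 1 / Real.sqrt (A ^ 2 / 2 * (1 + Real.sin θ ^ 2) - 1) := by
  refine continuous_const.div (by fun_prop) fun θ => ?_
  exact (Real.sqrt_pos.2 (radicand_pos hA θ)).ne'

theorem image_mul_sin_Ioo {A : ℝ} (hA : 0 < A) :
    (fun θ => A * Real.sin θ) '' Set.Ioo 0 (Real.pi / 2) = Set.Ioo 0 A := by
  ext u
  constructor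
  · rintro ⟨θ, ⟨h0, h1⟩, rfl⟩
    have hs : 0 < Real.sin θ := Real.sin_pos_of_pos_of_lt_pi h0 (by linarith [Real.pi_pos])
    have hs' : Real.sin θ < 1 := by
      rw [← Real.sin_pi_div_two]
      exact Real.sin_lt_sin_of_lt_of_le_pi_div_two (by linarith) le_rfl h1
    exact ⟨mul_pos hA hs, by nlinarith⟩
  · rintro ⟨h0, h1⟩
    have hlt : u / A < 1 := (div_lt_one hA).2 h1
    have hpos : 0 < u / A := div_pos h0 hA
    refine ⟨Real.arcsin (u / A), ⟨Real.arcsin_pos.2 hpos, Real.arcsin_lt_pi_div_two.2 hlt⟩, ?_⟩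
    simp only
    rw [Real.sin_arcsin (by linarith) hlt.le]
    field_simp

/-- The substitution `u = A sin θ` turns the period into a proper integral. -/
theorem Pminus_eq_regular {A : ℝ} (hA : Real.sqrt 2 < A) :
    Pminus A = 4 * ∫ θ in (0:ℝ)..(Real.pi / 2),
      1 / Real.sqrt (A ^ 2 / 2 * (1 + Real.sin θ ^ 2) - 1) := by
  have hA0 : 0 < A := (Real.sqrt_nonneg 2).trans_lt hA
  have hinj : Set.InjOn (fun θ => A * Real.sin θ) (Set.Ioo 0 (Real.pi / 2)) := by
    intro x hx y hy hxy
    refine Real.injOn_sin ⟨?_, hx.2.le⟩ ⟨?_, hy.2.le⟩ (mul_left_cancel₀ hA0.ne' hxy)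
    · linarith [hx.1, Real.pi_pos]
    · linarith [hy.1, Real.pi_pos]
  have hsub := MeasureTheory.integral_image_eq_integral_abs_deriv_smul
    (measurableSet_Ioo : MeasurableSet (Set.Ioo 0 (Real.pi / 2)))
    (fun θ _ => ((Real.hasDerivAt_sin θ).const_mul A).hasDerivWithinAt) hinj
    (fun u => 1 / Real.sqrt ((A ^ 2 - u ^ 2) * (A ^ 2 / 2 + u ^ 2 / 2 - 1)))
  rw [image_mul_sin_Ioo hA0] at hsub
  rw [Pminus, intervalIntegral.integral_of_le hA0.le,
    intervalIntegral.integral_of_le Real.pi_div_two_pos.le,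
    MeasureTheory.integral_Ioc_eq_integral_Ioo, MeasureTheory.integral_Ioc_eq_integral_Ioo, hsub]
  congr 1
  refine MeasureTheory.setIntegral_congr_fun measurableSet_Ioo fun θ hθ => ?_
  have hc : 0 < Real.cos θ :=
    Real.cos_pos_of_mem_Ioo ⟨by linarith [hθ.1, Real.pi_pos], hθ.2⟩
  have hAc : 0 < A * Real.cos θ := mul_pos hA0 hc
  have hfac : (A ^ 2 - (A * Real.sin θ) ^ 2) * (A ^ 2 / 2 + (A * Real.sin θ) ^ 2 / 2 - 1)
      = (A * Real.cos θ) ^ 2 * (A ^ 2 / 2 * (1 + Real.sin θ ^ 2) - 1) := by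
    rw [mul_pow A (Real.cos θ), Real.cos_sq']
    ring
  simp only [smul_eq_mul]
  rw [hfac, Real.sqrt_mul (sq_nonneg _), Real.sqrt_sq hAc.le, abs_of_pos hAc]
  have := (Real.sqrt_pos.2 (radicand_pos hA θ)).ne'
  field_simp

theorem Pminus_strictAntiOn : StrictAntiOn Pminus (Set.Ioi (Real.sqrt 2)) := by
  intro A hA B hB hAB
  have hA0 : 0 < A := (Real.sqrt_nonneg 2).trans_lt hA
  rw [Pminus_eq_regular hA, Pminus_eq_regular hB]
  have hlt : ∀ θ : ℝ, 1 / Real.sqrt (B ^ 2 / 2 * (1 + Real.sin θ ^ 2) - 1)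
      < 1 / Real.sqrt (A ^ 2 / 2 * (1 + Real.sin θ ^ 2) - 1) := by
    intro θ
    refine one_div_lt_one_div_of_lt (Real.sqrt_pos.2 (radicand_pos hA θ))
      (Real.sqrt_lt_sqrt (radicand_pos hA θ).le ?_)
    gcongr
  refine mul_lt_mul_of_pos_left ?_ four_pos
  exact intervalIntegral.integral_lt_integral_of_continuousOn_of_le_of_exists_lt
    Real.pi_div_two_pos (continuous_regularIntegrand hB).continuousOn
    (continuous_regularIntegrand hA).continuousOn (fun θ _ => (hlt θ).le)
    ⟨0, ⟨le_rfl, Real.pi_div_two_pos.le⟩, hlt 0⟩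

theorem Pminus_nonneg {A : ℝ} (hA : Real.sqrt 2 < A) : 0 ≤ Pminus A := by
  rw [Pminus_eq_regular hA]
  exact mul_nonneg four_pos.le
    (intervalIntegral.integral_nonneg Real.pi_div_two_pos.le fun θ _ => by positivity)

theorem Pminus_le {A : ℝ} (hA : Real.sqrt 2 < A) :
    Pminus A ≤ 2 * Real.pi * (Real.sqrt (A ^ 2 / 2 - 1))⁻¹ := by
  have h := intervalIntegral.integral_mono_on Real.pi_div_two_pos.le
    ((continuous_regularIntegrand hA).intervalIntegrable 0 (Real.pi / 2))
    (intervalIntegrable_const (μ := MeasureTheory.volume) (c := 1 / Real.sqrt (A ^ 2 / 2 - 1)))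
    fun θ _ => one_div_le_one_div_of_le (Real.sqrt_pos.2 (half_sq_sub_one_pos hA))
      (Real.sqrt_le_sqrt (half_sq_sub_one_le A θ))
  rw [intervalIntegral.integral_const, smul_eq_mul, one_div, sub_zero] at h
  rw [Pminus_eq_regular hA]
  linarith

theorem le_Pminus {A : ℝ} (hA : Real.sqrt 2 < A) (hA2 : A < 2) :
    2 * Real.log (1 + Real.pi / 2 * (Real.sqrt (A ^ 2 / 2 - 1))⁻¹) ≤ Pminus A := by
  have hpi := Real.pi_div_two_pos
  have hA0 : 0 < A := (Real.sqrt_nonneg 2).trans_lt hA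
  have hε := half_sq_sub_one_pos hA
  set s := Real.sqrt (A ^ 2 / 2 - 1) with hs
  have hs0 : 0 < s := Real.sqrt_pos.2 hε
  have hss : s ^ 2 = A ^ 2 / 2 - 1 := Real.sq_sqrt hε.le
  have hlog : ∫ θ in (0:ℝ)..(Real.pi / 2), (1 / 2) * (θ + s)⁻¹
      = (1 / 2) * Real.log (1 + Real.pi / 2 * s⁻¹) := by
    rw [intervalIntegral.integral_const_mul,
      intervalIntegral.integral_comp_add_right (fun x : ℝ => x⁻¹) s,
      integral_inv_of_pos (by linarith) (by linarith)]
    congr 2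
    field_simp
    ring
  have hint : IntervalIntegrable (fun θ : ℝ => (1 / 2) * (θ + s)⁻¹) MeasureTheory.volume
      0 (Real.pi / 2) := by
    refine ContinuousOn.intervalIntegrable_of_Icc hpi.le ?_
    refine continuousOn_const.mul (ContinuousOn.inv₀ (by fun_prop) fun θ hθ => ?_)
    linarith [hθ.1]
  have h := intervalIntegral.integral_mono_on hpi.le hint
    ((continuous_regularIntegrand hA).intervalIntegrable 0 (Real.pi / 2)) fun θ hθ => by
      have hsin : Real.sin θ ^ 2 ≤ θ ^ 2 :=
        pow_le_pow_left₀ (Real.sin_nonneg_of_nonneg_of_le_pi hθ.1 (by linarith [hθ.2]))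
          (Real.sin_le hθ.1) 2
      have hle : Real.sqrt (A ^ 2 / 2 * (1 + Real.sin θ ^ 2) - 1) ≤ 2 * (θ + s) := by
        refine Real.sqrt_le_iff.2 ⟨by linarith [hθ.1], ?_⟩
        have hA4 : A ^ 2 / 2 ≤ 2 := by nlinarith
        nlinarith [mul_le_mul hA4 hsin (sq_nonneg _) zero_le_two, mul_nonneg hθ.1 hs0.le,
          sq_nonneg s, sq_nonneg θ]
      calc (1 / 2) * (θ + s)⁻¹ = 1 / (2 * (θ + s)) := by rw [one_div, one_div, mul_inv]
        _ ≤ _ := one_div_le_one_div_of_le (Real.sqrt_pos.2 (radicand_pos hA θ)) hle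
  rw [hlog] at h
  rw [Pminus_eq_regular hA]
  linarith

theorem tendsto_Pminus_sqrt_two :
    Tendsto Pminus (nhdsWithin (Real.sqrt 2) (Set.Ioi (Real.sqrt 2))) atTop := by
  have hlt : Real.sqrt 2 < 2 := (Real.sqrt_lt' two_pos).2 (by norm_num)
  have hs : Tendsto (fun A : ℝ => Real.sqrt (A ^ 2 / 2 - 1))
      (nhdsWithin (Real.sqrt 2) (Set.Ioi (Real.sqrt 2))) (nhdsWithin 0 (Set.Ioi 0)) := by
    refine tendsto_nhdsWithin_iff.2 ⟨?_, ?_⟩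
    · have hc : Continuous fun A : ℝ => Real.sqrt (A ^ 2 / 2 - 1) := by fun_prop
      have := (hc.tendsto (Real.sqrt 2)).mono_left
        (nhdsWithin_le_nhds (s := Set.Ioi (Real.sqrt 2)))
      simpa using this
    · filter_upwards [self_mem_nhdsWithin] with A hA
      exact Real.sqrt_pos.2 (half_sq_sub_one_pos hA)
  have hlog := ((Real.tendsto_log_atTop.comp (tendsto_atTop_add_const_left _ 1
    ((tendsto_inv_nhdsGT_zero.comp hs).const_mul_atTop Real.pi_div_two_pos))).const_mul_atTop
    (two_pos (α := ℝ)))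
  refine tendsto_atTop_mono' _ ?_ hlog
  filter_upwards [Ioo_mem_nhdsGT hlt] with A hA
  exact le_Pminus hA.1 hA.2

theorem tendsto_Pminus_atTop : Tendsto Pminus atTop (nhds 0) := by
  have hsq : Tendsto (fun A : ℝ => A ^ 2 / 2 - 1) atTop atTop :=
    tendsto_atTop_add_const_right _ _ ((tendsto_pow_atTop two_ne_zero).atTop_div_const two_pos)
  have hub := (tendsto_inv_atTop_zero.comp (Real.tendsto_sqrt_atTop.comp hsq)).const_mul
    (2 * Real.pi)
  rw [mul_zero] at hub
  refine squeeze_zero' ?_ ?_ hub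
  · filter_upwards [eventually_gt_atTop (Real.sqrt 2)] with A hA using Pminus_nonneg hA
  · filter_upwards [eventually_gt_atTop (Real.sqrt 2)] with A hA using Pminus_le hA

/-- `P₋` is strictly decreasing on `(√2, ∞)`, tends to `+∞` as `A → √2⁺`,
and tends to `0` as `A → ∞`. -/
theorem Pminus_strictAnti_and_limits :
    StrictAntiOn Pminus (Set.Ioi (Real.sqrt 2)) ∧
    Tendsto Pminus (nhdsWithin (Real.sqrt 2) (Set.Ioi (Real.sqrt 2))) atTop ∧
    Tendsto Pminus atTop (nhds 0) :=
  ⟨Pminus_strictAntiOn, tendsto_Pminus_sqrt_two, tendsto_Pminus_atTop⟩
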